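/- Consider the reactive SAIS model and suppose β > δ, the functions α_i, α_a, p are nondecreasing on [0,1], δ ≥ β_a, and the function δ_a decreases steeply enough that β_a ≤ −δ_a'(i) for all i ∈ [0,1]. If (β − δ)/(β − β_a) > 1 − δ_a(0)/α_a(0), then there exists exactly one interior equilibrium, i.e., exactly one point (a*, i*) with a* > 0, i* > 0, a* + i* < 1 at which both right-hand sides of the system vanish. -/

import Mathlib

open Set Filter

theorem sais_unique_interior_equilibrium_a3
    (αi αa p δa : ℝ → ℝ) (β βa δ : ℝ)
    (hαi_diff : DifferentiableOn ℝ αi (Set.Icc 0 1))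
    (hαa_diff : DifferentiableOn ℝ αa (Set.Icc 0 1))
    (hp_diff : DifferentiableOn ℝ p (Set.Icc 0 1))
    (hδa_diff : DifferentiableOn ℝ δa (Set.Icc 0 1))
    (hαi_nonneg : ∀ x ∈ Set.Icc (0:ℝ) 1, 0 ≤ αi x)
    (hαa_nonneg : ∀ x ∈ Set.Icc (0:ℝ) 1, 0 ≤ αa x)
    (hp_nonneg : ∀ x ∈ Set.Icc (0:ℝ) 1, 0 ≤ p x)
    (hδa_nonneg : ∀ x ∈ Set.Icc (0:ℝ) 1, 0 ≤ δa x)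
    (hp_le_one : ∀ x ∈ Set.Icc (0:ℝ) 1, p x ≤ 1)
    (hδa0_pos : 0 < δa 0)
    (hαa_pos : ∀ x ∈ Set.Ioc (0:ℝ) 1, 0 < αa x)
    (hαip_pos : ∀ x ∈ Set.Ioc (0:ℝ) 1, 0 < αi x + p x)
    (hβa_nonneg : 0 ≤ βa) (hβaβ : βa < β) (hδ_pos : 0 < δ)
    (hβδ : δ < β)
    (hαi_mono : MonotoneOn αi (Set.Icc 0 1))
    (hαa_mono : MonotoneOn αa (Set.Icc 0 1))
    (hp_mono : MonotoneOn p (Set.Icc 0 1))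
    (hδβa : βa ≤ δ)
    (δa' : ℝ → ℝ)
    (hδa_deriv : ∀ x ∈ Set.Icc (0:ℝ) 1, HasDerivWithinAt δa (δa' x) (Set.Icc 0 1) x)
    (hδa_steep : ∀ x ∈ Set.Icc (0:ℝ) 1, βa ≤ - δa' x)
    (hthr : (β - δ) / (β - βa) > 1 - δa 0 / αa 0) :
    ∃! e : ℝ × ℝ, 0 < e.1 ∧ 0 < e.2 ∧ e.1 + e.2 < 1 ∧
      αi (e.2) * (1 - e.1 - e.2) * (e.2) + αa (e.2) * (1 - e.1 - e.2) * (e.1) + p (e.2) * δ * (e.2) - βa * (e.1) * (e.2) - δa (e.2) * (e.1) = 0 ∧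
      (β * (1 - e.1 - e.2) + βa * (e.1) - δ) * (e.2) = 0 := by
  have hb : 0 < β - βa := by linarith
  have hβ : 0 < β := by linarith
  have hanti : ∀ x ∈ Set.Icc (0:ℝ) 1, ∀ y ∈ Set.Icc (0:ℝ) 1, x ≤ y →
      βa * y + δa y ≤ βa * x + δa x := by
    have h : AntitoneOn (fun x => βa * x + δa x) (Set.Icc (0:ℝ) 1) := by
      apply antitoneOn_of_hasDerivWithinAt_nonpos (f' := fun x => βa * 1 + δa' x) (convex_Icc 0 1)
      · exact (continuousOn_const.mul continuousOn_id).add hδa_diff.continuousOn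
      · intro x hx
        have hx' := interior_subset hx
        exact (((hasDerivWithinAt_id x _).const_mul βa).add
          ((hδa_deriv x hx').mono interior_subset))
      · intro x hx
        have := hδa_steep x (interior_subset hx)
        linarith
    intro x hx y hy hxy
    exact h hx hy hxy
  have key : ∀ a i c j : ℝ, 0 < a → 0 < i → a + i < 1 → 0 < c → 0 < j → c + j < 1 →
      αi i * (1 - a - i) * i + αa i * (1 - a - i) * a + p i * δ * i - βa * a * i - δa i * a = 0 →
      β * (1 - a - i) + βa * a - δ = 0 →
      αi j * (1 - c - j) * j + αa j * (1 - c - j) * c + p j * δ * j - βa * c * j - δa j * c = 0 →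
      β * (1 - c - j) + βa * c - δ = 0 → i < j → False := by
    intro a i c j ha hi hai hc hj hcj e1 e2 e3 e4 hij
    have hiI : i ∈ Set.Icc (0:ℝ) 1 := ⟨hi.le, by linarith⟩
    have hjI : j ∈ Set.Icc (0:ℝ) 1 := ⟨hj.le, by linarith⟩
    have hca : c < a := by
      have h1 : (β - βa) * (a - c) = β * (j - i) := by linear_combination e4 - e2
      have h2 : 0 < (β - βa) * (a - c) := by rw [h1]; exact mul_pos hβ (by linarith)
      have := pos_of_mul_pos_right h2 hb.le
      linarith
    have hs : 1 - a - i ≤ 1 - c - j := by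
      have h1 : (β - βa) * ((1 - c - j) - (1 - a - i)) = βa * (j - i) := by
        linear_combination e4 - e2
      have h2 : 0 ≤ (β - βa) * ((1 - c - j) - (1 - a - i)) := by
        rw [h1]; exact mul_nonneg hβa_nonneg (by linarith)
      have := nonneg_of_mul_nonneg_right h2 hb
      linarith
    have m1 := hαi_mono hiI hjI hij.le
    have m2 := hαa_mono hiI hjI hij.le
    have m3 := hp_mono hiI hjI hij.le
    have m4 := hanti i hiI j hjI hij.le
    have n1 := hαi_nonneg i hiI
    have n2 := hαa_nonneg i hiI
    have n3 := hp_nonneg i hiI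
    have n4 := hαip_pos i ⟨hi, hiI.2⟩
    have hs0 : 0 < 1 - a - i := by linarith
    have hs1 : 0 < 1 - c - j := by linarith
    generalize hs' : 1 - a - i = s at *
    generalize ht' : 1 - c - j = t at *
    have k1 : αi i * s ≤ αi j * t := mul_le_mul m1 hs hs0.le (n1.trans m1)
    have k2 : αa i * s ≤ αa j * t := mul_le_mul m2 hs hs0.le (n2.trans m2)
    have k3 : p i * δ ≤ p j * δ := mul_le_mul_of_nonneg_right m3 hδ_pos.le
    have k4 : 0 < αi i * s + p i * δ := by
      rcases n1.lt_or_eq with h | h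
      · have := mul_pos h hs0
        have := mul_nonneg n3 hδ_pos.le
        linarith
      · have := mul_pos (show 0 < p i by linarith) hδ_pos
        have := mul_nonneg n1 hs0.le
        linarith
    obtain ⟨K, hK⟩ : ∃ K, K = αi i * s + p i * δ := ⟨_, rfl⟩
    obtain ⟨L, hL⟩ : ∃ K, K = αi j * t + p j * δ := ⟨_, rfl⟩
    obtain ⟨G, hG⟩ : ∃ K, K = αa i * s - (βa * i + δa i) := ⟨_, rfl⟩
    obtain ⟨H, hH⟩ : ∃ K, K = αa j * t - (βa * j + δa j) := ⟨_, rfl⟩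
    have f1 : i * K + a * G = 0 := by rw [hK, hG]; linear_combination e1
    have f2 : j * L + c * H = 0 := by rw [hL, hH]; linear_combination e3
    have hKL : K ≤ L := by linarith
    have hGH : G ≤ H := by linarith
    have hK0 : 0 < K := by linarith
    have hiK : 0 < i * K := mul_pos hi hK0
    have g1 : i * K < j * L := mul_lt_mul hij hKL hK0 hj.le
    have hG0 : G < 0 := by
      by_contra h
      have := mul_nonneg ha.le (not_lt.mp h)
      linarith
    have g2 : c * G ≤ c * H := mul_le_mul_of_nonneg_left hGH hc.le
    have g3 : a * G < c * G := mul_lt_mul_of_neg_right hca hG0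
    linarith
  -- existence
  have hα0 : 0 < αa 0 := by
    rcases (hαa_nonneg 0 (by simp)).lt_or_eq with h | h
    · exact h
    · rw [← h, div_zero, sub_zero, gt_iff_lt, lt_div_iff₀ hb] at hthr
      linarith
  have hth : αa 0 * ((δ - βa) / (β - βa)) < δa 0 := by
    have h1 : (δ - βa) / (β - βa) = 1 - (β - δ) / (β - βa) := by field_simp; ring
    have h2 : (δ - βa) / (β - βa) < δa 0 / αa 0 := by rw [h1]; linarith
    rw [lt_div_iff₀ hα0] at h2
    linarith
  set A : ℝ → ℝ := fun i => (β - δ - β * i) / (β - βa) with hA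
  set S : ℝ → ℝ := fun i => 1 - A i - i with hS
  have hAe : ∀ i, (β - βa) * A i = β - δ - β * i := by
    intro i; simp only [hA]; field_simp
  have hSe : ∀ i, (β - βa) * S i = δ - βa + βa * i := by
    intro i; simp only [hS]; linear_combination - hAe i
  have hSpos : ∀ i, 0 < i → 0 < S i := by
    intro i hi
    have h : 0 < (β - βa) * S i := by
      rw [hSe]
      rcases hδβa.lt_or_eq with h | h
      · have := mul_nonneg hβa_nonneg hi.le
        linarith
      · have := mul_pos (h ▸ hδ_pos : 0 < βa) hi
        linarith
    exact pos_of_mul_pos_right h hb.le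
  set m := (β - δ) / β with hm
  have hm0 : 0 < m := div_pos (by linarith) hβ
  have hm1 : m < 1 := by rw [hm, div_lt_one hβ]; linarith
  have hβm : β * m = β - δ := by rw [hm]; field_simp
  have hAm : A m = 0 := by simp only [hA, hβm]; simp
  set F : ℝ → ℝ := fun i => αi i * S i * i + αa i * S i * A i + p i * δ * i - βa * A i * i
    - δa i * A i with hF
  have hsub : Set.Icc 0 m ⊆ Set.Icc (0:ℝ) 1 := Set.Icc_subset_Icc_right hm1.le
  have hAc : ContinuousOn A (Set.Icc 0 m) := by
    apply Continuous.continuousOn; simp only [hA]; fun_prop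
  have hSc : ContinuousOn S (Set.Icc 0 m) := (continuousOn_const.sub hAc).sub continuousOn_id
  have hFc : ContinuousOn F (Set.Icc 0 m) := by
    have c1 := hαi_diff.continuousOn.mono hsub
    have c2 := hαa_diff.continuousOn.mono hsub
    have c3 := hp_diff.continuousOn.mono hsub
    have c4 := hδa_diff.continuousOn.mono hsub
    have c5 : ContinuousOn (fun i : ℝ => i) (Set.Icc 0 m) := continuousOn_id
    exact (((((c1.mul hSc).mul c5).add ((c2.mul hSc).mul hAc)).add
      ((c3.mul continuousOn_const).mul c5)).sub ((continuousOn_const.mul hAc).mul c5)).sub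
      (c4.mul hAc)
  have hF0 : F 0 < 0 := by
    have hS0 : S 0 = (δ - βa) / (β - βa) := by
      rw [eq_div_iff hb.ne']; linear_combination hSe 0
    have hA0 : 0 < A 0 := by
      simp only [hA]; exact div_pos (by linarith) hb
    have : F 0 = - ((δa 0 - αa 0 * S 0) * A 0) := by simp only [hF]; ring
    rw [this, hS0]
    exact neg_neg_of_pos (mul_pos (by linarith) hA0)
  have hFm : 0 < F m := by
    have hmI : m ∈ Set.Icc (0:ℝ) 1 := ⟨hm0.le, hm1.le⟩
    have n1 := hαi_nonneg m hmI
    have n3 := hp_nonneg m hmI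
    have n4 := hαip_pos m ⟨hm0, hm1.le⟩
    have hs := hSpos m hm0
    have : F m = (αi m * S m + p m * δ) * m := by simp only [hF, hAm]; ring
    rw [this]
    apply mul_pos _ hm0
    rcases n1.lt_or_eq with h | h
    · have := mul_pos h hs
      have := mul_nonneg n3 hδ_pos.le
      linarith
    · have := mul_pos (show 0 < p m by linarith) hδ_pos
      have := mul_nonneg n1 hs.le
      linarith
  obtain ⟨i, hi, hFi⟩ := intermediate_value_Ioo hm0.le hFc ⟨hF0, hFm⟩
  have hAi : 0 < A i := by
    simp only [hA]
    apply div_pos _ hb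
    have := mul_lt_mul_of_pos_left hi.2 hβ
    linarith
  have hSi := hSpos i hi.1
  have hEi : β * (1 - A i - i) + βa * A i - δ = 0 := by linear_combination - hAe i
  refine ⟨(A i, i), ⟨hAi, hi.1, ?_, hFi, ?_⟩, ?_⟩
  · simp only [hS] at hSi
    show A i + i < 1
    linarith
  · show (β * (1 - A i - i) + βa * A i - δ) * i = 0
    rw [hEi, zero_mul]
  · rintro ⟨c, j⟩ ⟨hc, hj, hcj, e3, e4⟩
    dsimp only at hc hj hcj e3 e4
    have e4' := (mul_eq_zero.mp e4).resolve_right hj.ne'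
    have hsum : A i + i < 1 := by
      simp only [hS] at hSi
      linarith
    rcases lt_trichotomy i j with h | h | h
    · exact (key (A i) i c j hAi hi.1 hsum hc hj hcj hFi hEi e3 e4' h).elim
    · subst h
      have : c = A i := mul_left_cancel₀ hb.ne' (by rw [hAe]; linear_combination - e4')
      rw [this]
    · exact (key c j (A i) i hc hj hcj hAi hi.1 hsum e3 e4' hFi hEi h).elim
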